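/- Let λ ∈ ℝ. Suppose that for every ε > 0 there exists a graph G with λ₁(G) ∈ (−λ − ε, −λ). Then the family G(λ) of all graphs whose smallest eigenvalue is at least −λ has no finite forbidden subgraph characterization. -/

import Mathlib

open Classical

/-- An eigenvalue of a real matrix indexed by a finite type. -/
def IsEigenvalue {V : Type*} [Fintype V] (A : Matrix V V ℝ) (μ : ℝ) : Prop :=
  ∃ v : V → ℝ, v ≠ 0 ∧ A.mulVec v = μ • v

/-- The adjacency matrix (over ℝ) of a simple graph. -/
noncomputable def adjMat {V : Type*} [Fintype V] (G : SimpleGraph V) : Matrix V V ℝ :=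
  fun i j => if G.Adj i j then 1 else 0

/-- The smallest eigenvalue of a real matrix (for a symmetric matrix on a nonempty finite
index type this is the minimum of the spectrum). -/
noncomputable def minEig {V : Type*} [Fintype V] (A : Matrix V V ℝ) : ℝ :=
  sInf {μ : ℝ | IsEigenvalue A μ}

/-- A family of graphs (given as a predicate on graphs on `Fin n` for all `n`) has a finite
forbidden (induced) subgraph characterization. -/
def HasFiniteForbiddenCharacterization (P : ∀ n : ℕ, SimpleGraph (Fin n) → Prop) : Prop :=
  ∃ (k : ℕ) (N : Fin k → ℕ) (F : ∀ i : Fin k, SimpleGraph (Fin (N i))),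
    ∀ (n : ℕ) (G : SimpleGraph (Fin n)),
      P n G ↔ ∀ i : Fin k, IsEmpty (F i ↪g G)

theorem adjMat_isHermitian {V : Type*} [Fintype V] (G : SimpleGraph V) :
    (adjMat G).IsHermitian := by
  ext i j
  simp [adjMat, G.adj_comm]

theorem isEigenvalue_eigenvalues {V : Type*} [Fintype V] {A : Matrix V V ℝ}
    (hA : A.IsHermitian) (i : V) : IsEigenvalue A (hA.eigenvalues i) := by
  refine ⟨hA.eigenvectorBasis i, fun h0 => ?_, hA.mulVec_eigenvectorBasis i⟩
  exact hA.eigenvectorBasis.toBasis.ne_zero i (by ext j; simpa using congrFun h0 j)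

theorem finite_isEigenvalue {V : Type*} [Fintype V] (A : Matrix V V ℝ) :
    {μ : ℝ | IsEigenvalue A μ}.Finite := by
  refine (Module.End.finite_hasEigenvalue (Matrix.toLin' A)).subset ?_
  rintro μ ⟨v, hv, h⟩
  exact Module.End.hasEigenvalue_of_hasEigenvector
    (Module.End.hasEigenvector_iff.mpr
      ⟨Module.End.mem_eigenspace_iff.mpr (by simpa using h), hv⟩)

/-- A symmetric matrix all of whose eigenvalues exceed `μ` is positive definite after
subtracting `μ`. -/
theorem posDef_sub_smul_one {V : Type*} [Fintype V] {A : Matrix V V ℝ} (hA : A.IsHermitian)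
    {μ : ℝ} (h : ∀ ν, IsEigenvalue A ν → μ < ν) : (A - μ • (1 : Matrix V V ℝ)).PosDef := by
  have hB : (A - μ • (1 : Matrix V V ℝ)).IsHermitian :=
    hA.sub (by ext i j; simp [Matrix.one_apply, eq_comm])
  refine hB.posDef_iff_eigenvalues_pos.mpr fun i => ?_
  obtain ⟨v, hv, hvB⟩ := isEigenvalue_eigenvalues hB i
  have key : IsEigenvalue A (hB.eigenvalues i + μ) := by
    refine ⟨v, hv, ?_⟩
    rw [Matrix.sub_mulVec, Matrix.smul_mulVec, Matrix.one_mulVec, sub_eq_iff_eq_add] at hvB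
    rw [hvB, add_smul]
  linarith [h _ key]

/-- Interlacing: an eigenvalue of an induced subgraph bounds some eigenvalue of the graph from
above. -/
theorem exists_isEigenvalue_le_of_embedding {V W : Type*} [Fintype V] [Fintype W]
    {F : SimpleGraph V} {G : SimpleGraph W} (f : F ↪g G) {μ : ℝ}
    (h : IsEigenvalue (adjMat F) μ) : ∃ ν ≤ μ, IsEigenvalue (adjMat G) ν := by
  by_contra! hν
  have hpos := (posDef_sub_smul_one (adjMat_isHermitian G) (μ := μ)
    fun ν hG => lt_of_not_ge fun hle => hν ν hle hG).submatrix f.injective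
  have hsub : (adjMat G - μ • (1 : Matrix W W ℝ)).submatrix f f
      = adjMat F - μ • (1 : Matrix V V ℝ) := by
    ext i j
    simp [adjMat, Matrix.one_apply]
  rw [hsub] at hpos
  obtain ⟨v, hv, hvF⟩ := h
  have := hpos.dotProduct_mulVec_pos hv
  simp [Matrix.sub_mulVec, Matrix.smul_mulVec, hvF] at this

/-- If for every `ε > 0` some graph has smallest eigenvalue in `(-λ - ε, -λ)`, then the family
of graphs with smallest eigenvalue at least `-λ` has no finite forbidden subgraph
characterization. -/
theorem no_ffc_of_smallest_eigenvalues_approach (lam : ℝ)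
    (h : ∀ ε : ℝ, 0 < ε → ∃ (n : ℕ) (G : SimpleGraph (Fin n)), 0 < n ∧
        -lam - ε < minEig (adjMat G) ∧ minEig (adjMat G) < -lam) :
    ¬ HasFiniteForbiddenCharacterization
        (fun _ G => ∀ μ : ℝ, IsEigenvalue (adjMat G) μ → -lam ≤ μ) := by
  rintro ⟨k, N, F, hF⟩
  have hbad : ∀ i, ∃ μ < -lam, IsEigenvalue (adjMat (F i)) μ := by
    intro i
    by_contra! hi
    have hi' := (hF (N i) (F i)).mp fun μ hμ => le_of_not_gt fun hlt => hi μ hlt hμ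
    exact (hi' i).false SimpleGraph.Embedding.refl
  choose μ hμ hFμ using hbad
  obtain ⟨ε, hε, hε0⟩ : ∃ ε : ℝ, (∀ i, ε < -lam - μ i) ∧ 0 < ε := by
    have hev : ∀ᶠ ε in nhdsWithin (0 : ℝ) (Set.Ioi 0), ∀ i, ε < -lam - μ i :=
      Filter.eventually_all.mpr fun i =>
        ((eventually_lt_nhds (sub_pos.mpr (hμ i))).filter_mono nhdsWithin_le_nhds)
    exact (hev.and self_mem_nhdsWithin).exists
  obtain ⟨n, G, hn, hlo, hhi⟩ := h ε hε0
  obtain ⟨ν, hν, hνlt⟩ := exists_lt_of_csInf_lt (s := {μ : ℝ | IsEigenvalue (adjMat G) μ})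
    ⟨_, isEigenvalue_eigenvalues (adjMat_isHermitian G) ⟨0, hn⟩⟩ hhi
  have hG := (hF n G).not.mp fun hall => (hall ν hν).not_gt hνlt
  push Not at hG
  obtain ⟨i, ⟨f⟩⟩ := hG
  obtain ⟨ρ, hρ, hρG⟩ := exists_isEigenvalue_le_of_embedding f (hFμ i)
  have hmin : minEig (adjMat G) ≤ ρ := csInf_le (finite_isEigenvalue _).bddBelow hρG
  linarith [hε i]
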